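/- Let 5 < p < 6. There exists a constant C > 0 depending only on p such that for every T ∈ (0,∞] and every smooth solution u : [0, T) × ℝ → ℝ of ∂ₜu + ∂ₓ(∂ₓₓu + u|u|^{p−1}) = 0 with u(t,·) and all its x-derivatives decaying rapidly at spatial infinity, locally uniformly in t, the functional E₂(t) = ∫_ℝ (∂ₓₓu(t))² dx − (5p/3)∫_ℝ (∂ₓu(t))² |u(t)|^{p−1} dx satisfies, for all t ∈ [0, T): d/dt E₂(t) ≤ C ( ∫_ℝ |∂ₓu(t)|³ |u(t)|^{2p−3} dx + ∫_ℝ |∂ₓu(t)|⁵ |u(t)|^{p−4} dx ). -/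

import Mathlib

noncomputable section

open Set Filter MeasureTheory

/-- The time domain `[0, T)` for `T ∈ (0, ∞]` (an extended real). -/
def timeDomain (T : EReal) : Set ℝ := {t : ℝ | 0 ≤ t ∧ (t : EReal) < T}

/-- `u` solves the gKdV equation `∂ₜu + ∂ₓ(∂ₓₓu + u|u|^{p-1}) = 0` on `[0,T) × ℝ`. -/
def IsGKdVSolution (p : ℝ) (T : EReal) (u : ℝ → ℝ → ℝ) : Prop :=
  ∀ t ∈ timeDomain T, ∀ x : ℝ,
    deriv (fun s => u s x) t +
      deriv (fun y => deriv (deriv (u t)) y + u t y * |u t y| ^ (p - 1)) x = 0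

/-- For each `t`, `u(t,·)` together with all its `x`-derivatives decays rapidly at spatial
infinity, locally uniformly in `t`. -/
def RapidDecayLocUnif (T : EReal) (u : ℝ → ℝ → ℝ) : Prop :=
  ∀ n k : ℕ, ∀ t₀ ∈ timeDomain T, ∃ ε > 0, ∃ C : ℝ,
    ∀ t ∈ timeDomain T, |t - t₀| < ε → ∀ x : ℝ,
      (1 + |x|) ^ n * |iteratedDeriv k (u t) x| ≤ C

/-- The `H²`-level pseudo-energy `E₂(t) = ∫ (∂ₓₓu)² - (5p/3)∫ (∂ₓu)²|u|^{p-1}`. -/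
def pseudoEnergy (p : ℝ) (u : ℝ → ℝ → ℝ) (t : ℝ) : ℝ :=
  (∫ x : ℝ, (deriv (deriv (u t)) x) ^ 2) -
    (5 * p / 3) * (∫ x : ℝ, (deriv (u t) x) ^ 2 * |u t x| ^ (p - 1))

open scoped Topology

/-! ### Differentiation under the integral sign, one-sided times included -/

theorem hasDerivWithinAt_integral_of_dominated {S : Set ℝ} (hS : Convex ℝ S)
    {F F' : ℝ → ℝ → ℝ} {bound : ℝ → ℝ} {t₀ : ℝ} (ht₀ : t₀ ∈ S)
    (hint : ∀ᶠ t in 𝓝[S] t₀, Integrable (F t))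
    (hF' : ∀ᶠ t in 𝓝[S] t₀, ∀ x, |F' t x| ≤ bound x) (hbound : Integrable bound)
    (hderiv : ∀ t ∈ S, ∀ x, HasDerivWithinAt (fun s => F s x) (F' t x) S t) :
    HasDerivWithinAt (fun t => ∫ x, F t x) (∫ x, F' t₀ x) S t₀ := by
  have hint₀ : Integrable (F t₀) := hint.self_of_nhdsWithin ht₀
  rw [hasDerivWithinAt_iff_tendsto_slope]
  have hle : 𝓝[S \ {t₀}] t₀ ≤ 𝓝[S] t₀ := nhdsWithin_mono _ sdiff_subset
  have hmem : ∀ᶠ t in 𝓝[S \ {t₀}] t₀, t ∈ S \ {t₀} := eventually_mem_nhdsWithin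
  have hslope : ∀ᶠ t in 𝓝[S \ {t₀}] t₀, ∀ x, |slope (fun s => F s x) t₀ t| ≤ bound x := by
    obtain ⟨ε, hε, hball⟩ := Metric.mem_nhdsWithin_iff.1 hF'
    have hconv : Convex ℝ (Metric.ball t₀ ε ∩ S) := (convex_ball _ _).inter hS
    have hnear : ∀ᶠ t in 𝓝[S \ {t₀}] t₀, t ∈ Metric.ball t₀ ε :=
      mem_nhdsWithin_of_mem_nhds (Metric.ball_mem_nhds _ hε)
    filter_upwards [hmem, hnear] with t ht htε x
    have hmv := hconv.norm_image_sub_le_of_norm_hasDerivWithin_le (f := fun s => F s x)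
      (f' := fun s => F' s x) (C := bound x)
      (fun s hs => (hderiv s hs.2 x).mono inter_subset_right)
      (fun s hs => hball hs x) ⟨Metric.mem_ball_self hε, ht₀⟩ ⟨htε, ht.1⟩
    have hne : 0 < |t - t₀| := abs_pos.2 (sub_ne_zero.2 ht.2)
    rw [slope_def_field, abs_div, div_le_iff₀ hne]
    exact hmv
  have hlim := tendsto_integral_filter_of_dominated_convergence (μ := volume)
    (l := 𝓝[S \ {t₀}] t₀) (F := fun t x => slope (fun s => F s x) t₀ t)
    (f := fun x => F' t₀ x) bound
    (by
      filter_upwards [hint.filter_mono hle] with t ht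
      simp only [slope_def_field]
      exact ((ht.sub hint₀).div_const _).aestronglyMeasurable)
    (by filter_upwards [hslope] with t ht using Eventually.of_forall ht) hbound
    (Eventually.of_forall fun x => hasDerivWithinAt_iff_tendsto_slope.1 (hderiv t₀ ht₀ x))
  refine hlim.congr' ?_
  filter_upwards [hint.filter_mono hle] with t ht
  simp only [slope_def_field]
  rw [integral_div, integral_sub ht hint₀]

/-! ### Partial derivatives of functions that are smooth on a strip -/

/-- The partial derivative of `g` in the direction `e`, within the strip `S × ℝ`. -/
def stripDeriv (S : Set ℝ) (e : ℝ × ℝ) (g : ℝ → ℝ → ℝ) (t x : ℝ) : ℝ :=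
  fderivWithin ℝ (fun q : ℝ × ℝ => g q.1 q.2) (S ×ˢ univ) (t, x) e

section Strip

variable {S : Set ℝ}

theorem uniqueDiffOn_strip (hS : Convex ℝ S) (hne : (interior S).Nonempty) :
    UniqueDiffOn ℝ (S ×ˢ (univ : Set ℝ)) :=
  (uniqueDiffOn_convex hS hne).prod uniqueDiffOn_univ

variable {g : ℝ → ℝ → ℝ}
  (hg : ContDiffOn ℝ (⊤ : ℕ∞) (fun q : ℝ × ℝ => g q.1 q.2) (S ×ˢ univ))

include hg

theorem hasDerivAt_stripDeriv {t : ℝ} (ht : t ∈ S) (x : ℝ) :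
    HasDerivAt (g t) (stripDeriv S (0, 1) g t x) x := by
  have h := ((hg.differentiableOn (by simp)) (t, x) ⟨ht, mem_univ x⟩).hasFDerivWithinAt
  have hl : HasDerivWithinAt (fun y : ℝ => (t, y)) ((0, 1) : ℝ × ℝ) univ x :=
    ((hasDerivAt_const x t).prodMk (hasDerivAt_id x)).hasDerivWithinAt
  exact hasDerivWithinAt_univ.1
    (h.comp_hasDerivWithinAt x hl fun y _ => ⟨ht, mem_univ y⟩)

theorem hasDerivWithinAt_stripDeriv {t : ℝ} (ht : t ∈ S) (x : ℝ) :
    HasDerivWithinAt (fun s => g s x) (stripDeriv S (1, 0) g t x) S t := by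
  have h := ((hg.differentiableOn (by simp)) (t, x) ⟨ht, mem_univ x⟩).hasFDerivWithinAt
  have hl : HasDerivWithinAt (fun s : ℝ => (s, x)) ((1, 0) : ℝ × ℝ) S t :=
    ((hasDerivAt_id t).prodMk (hasDerivAt_const t x)).hasDerivWithinAt
  have hmaps : MapsTo (fun s : ℝ => (s, x)) S (S ×ˢ univ) := fun s hs => ⟨hs, mem_univ x⟩
  exact h.comp_hasDerivWithinAt t hl hmaps

variable (hS : Convex ℝ S) (hne : (interior S).Nonempty)

include hS hne

theorem contDiffOn_stripDeriv (e : ℝ × ℝ) :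
    ContDiffOn ℝ (⊤ : ℕ∞) (fun q : ℝ × ℝ => stripDeriv S e g q.1 q.2) (S ×ˢ univ) := by
  have h : ContDiffOn ℝ (⊤ : ℕ∞) (fderivWithin ℝ (fun q : ℝ × ℝ => g q.1 q.2) (S ×ˢ univ))
      (S ×ˢ univ) := hg.fderivWithin (uniqueDiffOn_strip hS hne) (by simp)
  exact h.clm_apply contDiffOn_const

theorem stripDeriv_comm {t : ℝ} (ht : t ∈ S) (x : ℝ) (e e' : ℝ × ℝ) :
    stripDeriv S e (stripDeriv S e' g) t x = stripDeriv S e' (stripDeriv S e g) t x := by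
  have hU := uniqueDiffOn_strip hS hne
  have hmem : (t, x) ∈ S ×ˢ (univ : Set ℝ) := ⟨ht, mem_univ x⟩
  have h : ContDiffOn ℝ (⊤ : ℕ∞) (fderivWithin ℝ (fun q : ℝ × ℝ => g q.1 q.2) (S ×ˢ univ))
      (S ×ˢ univ) := hg.fderivWithin hU (by simp)
  have hd := ((h.differentiableOn (by simp)) (t, x) hmem).hasFDerivWithinAt
  have key : ∀ a b : ℝ × ℝ, stripDeriv S a (stripDeriv S b g) t x =
      fderivWithin ℝ (fderivWithin ℝ (fun q : ℝ × ℝ => g q.1 q.2) (S ×ˢ univ))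
        (S ×ˢ univ) (t, x) a b := by
    intro a b
    have := (hd.clm_apply (hasFDerivWithinAt_const b (t, x) (S ×ˢ univ))).fderivWithin
      (hU _ hmem)
    simp only [stripDeriv]
    rw [this]
    simp
  rw [key, key]
  refine (hg (t, x) hmem).isSymmSndFDerivWithinAt
    (by rw [minSmoothness_of_isRCLikeNormedField]; exact WithTop.coe_le_coe.2 le_top) hU ?_ hmem e e'
  have hint : (interior (S ×ˢ (univ : Set ℝ))).Nonempty := by
    rw [interior_prod_eq, interior_univ]
    exact hne.prod univ_nonempty
  rw [(hS.prod convex_univ).closure_interior_eq_closure_of_nonempty_interior hint]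
  exact subset_closure hmem

/-- The spatial derivative of the time derivative is the time derivative of the spatial one. -/
theorem hasDerivAt_stripDeriv_time {t : ℝ} (ht : t ∈ S) (x : ℝ) :
    HasDerivAt (stripDeriv S (1, 0) g t)
      (stripDeriv S (1, 0) (stripDeriv S (0, 1) g) t x) x := by
  rw [stripDeriv_comm hg hS hne ht x]
  exact hasDerivAt_stripDeriv (contDiffOn_stripDeriv hg hS hne (1, 0)) ht x

theorem contDiffOn_iterate_stripDeriv (k : ℕ) :
    ContDiffOn ℝ (⊤ : ℕ∞) (fun q : ℝ × ℝ => (stripDeriv S (0, 1))^[k] g q.1 q.2)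
      (S ×ˢ univ) := by
  induction k with
  | zero => exact hg
  | succ k ih =>
    rw [Function.iterate_succ_apply']
    exact contDiffOn_stripDeriv ih hS hne (0, 1)

theorem iteratedDeriv_eq_iterate_stripDeriv (k : ℕ) {t : ℝ} (ht : t ∈ S) :
    iteratedDeriv k (g t) = (stripDeriv S (0, 1))^[k] g t := by
  induction k with
  | zero => simp
  | succ k ih =>
    rw [iteratedDeriv_succ, ih, Function.iterate_succ_apply']
    funext x
    exact (hasDerivAt_stripDeriv (contDiffOn_iterate_stripDeriv hg hS hne k) ht x).deriv

end Strip

/-! ### The nonlinearity and its derivatives -/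

/-- The weight `|z| ^ (p - 1)`. -/
def weight (p z : ℝ) : ℝ := |z| ^ (p - 1)

/-- The first derivative of `weight p`. -/
def weight₁ (p z : ℝ) : ℝ := (p - 1) * |z| ^ (p - 3) * z

/-- The second derivative of `weight p`. -/
def weight₂ (p z : ℝ) : ℝ := (p - 1) * (p - 2) * |z| ^ (p - 3)

/-- The third derivative of `weight p`. -/
def weight₃ (p z : ℝ) : ℝ := (p - 1) * (p - 2) * (p - 3) * |z| ^ (p - 5) * z

section Weight

variable {p : ℝ}

theorem abs_rpow_mul_sq {a b z : ℝ} (ha : a ≠ 0) (hb : b = a - 2) :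
    |z| ^ b * z * z = |z| ^ a := by
  rcases eq_or_ne z 0 with rfl | hz
  · simp [Real.zero_rpow ha]
  · have h : a = b + (2 : ℕ) := by rw [hb]; push_cast; ring
    rw [h, Real.rpow_add (abs_pos.2 hz), Real.rpow_natCast, sq_abs]
    ring

theorem hasDerivAt_weight (hp : 5 < p) (z : ℝ) : HasDerivAt (weight p) (weight₁ p z) z := by
  have h := hasDerivAt_abs_rpow z (p := p - 1) (by linarith)
  rwa [show p - 1 - 2 = p - 3 by ring] at h

theorem hasDerivAt_weight₁ (hp : 5 < p) (z : ℝ) : HasDerivAt (weight₁ p) (weight₂ p z) z := by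
  have h := hasDerivAt_abs_rpow z (p := p - 3) (by linarith)
  have h' := (h.const_mul (p - 1)).mul (hasDerivAt_id z)
  refine h'.congr_deriv ?_
  have hz := abs_rpow_mul_sq (z := z) (show p - 3 ≠ 0 by linarith) rfl
  simp only [weight₂, id]
  linear_combination (p - 1) * (p - 3) * hz

theorem hasDerivAt_weight₂ (hp : 5 < p) (z : ℝ) : HasDerivAt (weight₂ p) (weight₃ p z) z := by
  have h := hasDerivAt_abs_rpow z (p := p - 3) (by linarith)
  rw [show p - 3 - 2 = p - 5 by ring] at h
  refine (h.const_mul ((p - 1) * (p - 2))).congr_deriv ?_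
  simp only [weight₃]
  ring

theorem weight₁_mul_self (hp : 5 < p) (z : ℝ) : weight₁ p z * z = (p - 1) * weight p z := by
  have hz := abs_rpow_mul_sq (z := z) (show p - 1 ≠ 0 by linarith) (show p - 3 = p - 1 - 2 by ring)
  simp only [weight₁, weight]
  linear_combination (p - 1) * hz

theorem abs_weight_mul_weight₁ (hp : 5 < p) (z : ℝ) :
    |weight p z * weight₁ p z| = (p - 1) * |z| ^ (2 * p - 3) := by
  have h1 : |z| ^ (p - 2) = |z| ^ (p - 3) * |z| := by
    rw [← Real.rpow_add_one' (abs_nonneg z) (by linarith)]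
    ring_nf
  have h2 : |z| ^ (2 * p - 3) = |z| ^ (p - 1) * |z| ^ (p - 2) := by
    rw [← Real.rpow_add' (abs_nonneg z) (by linarith)]
    ring_nf
  simp only [weight, weight₁, abs_mul, abs_of_nonneg (Real.rpow_nonneg (abs_nonneg z) _),
    abs_of_pos (show 0 < p - 1 by linarith)]
  rw [h2, h1]
  ring

theorem abs_weight₃ (hp : 5 < p) (z : ℝ) :
    |weight₃ p z| = (p - 1) * (p - 2) * (p - 3) * |z| ^ (p - 4) := by
  have h1 : |z| ^ (p - 4) = |z| ^ (p - 5) * |z| := by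
    rw [← Real.rpow_add_one' (abs_nonneg z) (by linarith)]
    ring_nf
  simp only [weight₃, abs_mul, abs_of_nonneg (Real.rpow_nonneg (abs_nonneg z) _),
    abs_of_pos (show 0 < p - 1 by linarith), abs_of_pos (show 0 < p - 2 by linarith),
    abs_of_pos (show 0 < p - 3 by linarith)]
  rw [h1]
  ring

theorem continuous_abs_rpow {a : ℝ} (ha : 0 ≤ a) : Continuous fun z : ℝ => |z| ^ a :=
  continuous_abs.rpow_const fun _ => Or.inr ha

theorem continuous_weight (hp : 5 < p) : Continuous (weight p) :=
  continuous_abs_rpow (by linarith)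

theorem continuous_weight₁ (hp : 5 < p) : Continuous (weight₁ p) :=
  (continuous_const.mul (continuous_abs_rpow (by linarith))).mul continuous_id

theorem continuous_weight₂ (hp : 5 < p) : Continuous (weight₂ p) :=
  continuous_const.mul (continuous_abs_rpow (by linarith))

theorem continuous_weight₃ (hp : 5 < p) : Continuous (weight₃ p) :=
  (continuous_const.mul (continuous_abs_rpow (by linarith))).mul continuous_id

end Weight

/-! ### Differential polynomials in the jet of the solution

The entry `j k` of a jet `j : Fin 6 → ℝ` stands for `∂ₓᵏ u`. -/

/-- `∂ₜ u`, expressed by the equation. -/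
def velocity (p : ℝ) (j : Fin 6 → ℝ) : ℝ := -j 3 - p * (weight p (j 0) * j 1)

/-- `∂ₓ ∂ₜ u`, expressed by the equation. -/
def velocity₁ (p : ℝ) (j : Fin 6 → ℝ) : ℝ :=
  -j 4 - p * (weight p (j 0) * j 2 + weight₁ p (j 0) * j 1 ^ 2)

/-- `∂ₓₓ ∂ₜ u`, expressed by the equation. -/
def velocity₂ (p : ℝ) (j : Fin 6 → ℝ) : ℝ :=
  -j 5 - p * (weight p (j 0) * j 3 + 3 * weight₁ p (j 0) * j 1 * j 2 +
    weight₂ p (j 0) * j 1 ^ 3)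

/-- The density of the time derivative of the quadratic part of the pseudo-energy. -/
def quadraticRate (p : ℝ) (j : Fin 6 → ℝ) : ℝ := j 2 * (2 * velocity₂ p j)

/-- The density of the time derivative of `∫ (∂ₓu)² |u|^(p-1)`. -/
def correctionRate (p : ℝ) (j : Fin 6 → ℝ) : ℝ :=
  j 1 * (2 * velocity₁ p j * weight p (j 0) + j 1 * weight₁ p (j 0) * velocity p j)

/-- What remains of the time derivative of the density after integration by parts. -/
def remainder (p : ℝ) (j : Fin 6 → ℝ) : ℝ :=
  j 1 * (p / 12 * weight₃ p (j 0) * j 1 ^ 4 +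
    5 * p ^ 2 / 3 * (weight p (j 0) * weight₁ p (j 0)) * j 1 ^ 2)

/-- The flux whose spatial derivative is removed by integration by parts. -/
def flux (p : ℝ) (j : Fin 6 → ℝ) : ℝ :=
  j 2 * (-(2 * j 4) - p * weight p (j 0) * j 2 -
      5 * p / 3 * (weight p (j 0) * j 2 + weight₁ p (j 0) * j 1 ^ 2)) +
    j 3 * j 3 +
    j 1 * (-(p / 2 * weight₂ p (j 0) * j 1 ^ 3) -
      5 * p / 3 * (2 * weight p (j 0) * velocity p j - weight₂ p (j 0) * j 1 ^ 3 / 4 +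
        p * weight p (j 0) ^ 2 * j 1))

/-- The sixth-order jet of a function. -/
def jet (w : ℝ → ℝ) (x : ℝ) (k : Fin 6) : ℝ := iteratedDeriv k w x

section Jet

variable {p : ℝ} {w : ℝ → ℝ} (hw : ∀ (k : ℕ) (x : ℝ),
  HasDerivAt (iteratedDeriv k w) (iteratedDeriv (k + 1) w x) x)

include hw

theorem continuous_jet : Continuous (jet w) :=
  continuous_pi fun k => continuous_iff_continuousAt.2 fun x => (hw k x).continuousAt

theorem hasDerivAt_velocity (hp : 5 < p) (x : ℝ) :
    HasDerivAt (fun y => velocity p (jet w y)) (velocity₁ p (jet w x)) x := by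
  have h0 : HasDerivAt (fun y => jet w y 0) (jet w x 1) x := hw 0 x
  have h1 : HasDerivAt (fun y => jet w y 1) (jet w x 2) x := hw 1 x
  have h3 : HasDerivAt (fun y => jet w y 3) (jet w x 4) x := hw 3 x
  have f0 : HasDerivAt (fun y => weight p (jet w y 0)) (weight₁ p (jet w x 0) * jet w x 1) x :=
    (hasDerivAt_weight hp (jet w x 0)).comp x h0
  refine (h3.neg.sub ((f0.mul h1).const_mul p)).congr_deriv ?_
  simp only [velocity₁]
  ring

theorem hasDerivAt_velocity₁ (hp : 5 < p) (x : ℝ) :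
    HasDerivAt (fun y => velocity₁ p (jet w y)) (velocity₂ p (jet w x)) x := by
  have h0 : HasDerivAt (fun y => jet w y 0) (jet w x 1) x := hw 0 x
  have h1 : HasDerivAt (fun y => jet w y 1) (jet w x 2) x := hw 1 x
  have h2 : HasDerivAt (fun y => jet w y 2) (jet w x 3) x := hw 2 x
  have h4 : HasDerivAt (fun y => jet w y 4) (jet w x 5) x := hw 4 x
  have f0 : HasDerivAt (fun y => weight p (jet w y 0)) (weight₁ p (jet w x 0) * jet w x 1) x :=
    (hasDerivAt_weight hp (jet w x 0)).comp x h0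
  have f1 : HasDerivAt (fun y => weight₁ p (jet w y 0)) (weight₂ p (jet w x 0) * jet w x 1) x :=
    (hasDerivAt_weight₁ hp (jet w x 0)).comp x h0
  refine (h4.neg.sub (((f0.mul h2).add (f1.mul (h1.pow 2))).const_mul p)).congr_deriv ?_
  simp only [velocity₂, Pi.pow_apply]
  push_cast
  ring

theorem hasDerivAt_flux (hp : 5 < p) (x : ℝ) :
    HasDerivAt (fun y => flux p (jet w y))
      (quadraticRate p (jet w x) - 5 * p / 3 * correctionRate p (jet w x) -
        remainder p (jet w x)) x := by
  have h0 : HasDerivAt (fun y => jet w y 0) (jet w x 1) x := hw 0 x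
  have h1 : HasDerivAt (fun y => jet w y 1) (jet w x 2) x := hw 1 x
  have h2 : HasDerivAt (fun y => jet w y 2) (jet w x 3) x := hw 2 x
  have h3 : HasDerivAt (fun y => jet w y 3) (jet w x 4) x := hw 3 x
  have h4 : HasDerivAt (fun y => jet w y 4) (jet w x 5) x := hw 4 x
  have f0 : HasDerivAt (fun y => weight p (jet w y 0)) (weight₁ p (jet w x 0) * jet w x 1) x :=
    (hasDerivAt_weight hp (jet w x 0)).comp x h0
  have f1 : HasDerivAt (fun y => weight₁ p (jet w y 0)) (weight₂ p (jet w x 0) * jet w x 1) x :=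
    (hasDerivAt_weight₁ hp (jet w x 0)).comp x h0
  have f2 : HasDerivAt (fun y => weight₂ p (jet w y 0)) (weight₃ p (jet w x 0) * jet w x 1) x :=
    (hasDerivAt_weight₂ hp (jet w x 0)).comp x h0
  have hv := hasDerivAt_velocity hw hp x
  refine (((h2.mul ((((h4.const_mul 2).neg).sub ((f0.const_mul p).mul h2)).sub
    (((f0.mul h2).add (f1.mul (h1.pow 2))).const_mul (5 * p / 3)))).add (h3.mul h3)).add
    (h1.mul ((((f2.const_mul (p / 2)).mul (h1.pow 3)).neg).sub
      ((((((f0.const_mul 2).mul hv)).sub ((f2.mul (h1.pow 3)).div_const 4)).add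
        (((f0.pow 2).const_mul p).mul h1)).const_mul (5 * p / 3))))).congr_deriv ?_
  simp only [quadraticRate, correctionRate, remainder, velocity, velocity₁, velocity₂,
    Pi.mul_apply, Pi.pow_apply, Pi.add_apply, Pi.sub_apply, Pi.neg_apply]
  push_cast
  ring

end Jet

section Decay

variable {w : ℝ → ℝ} {M : Fin 6 → ℝ}

/-- The jet of `w` decays quadratically, with constants `M`. -/
def JetDecay (M : Fin 6 → ℝ) (w : ℝ → ℝ) : Prop :=
  ∀ (k : Fin 6) (x : ℝ), |jet w x k| ≤ M k * (1 + x ^ 2)⁻¹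

theorem JetDecay.exists_bound (M : Fin 6 → ℝ) {Ψ : (Fin 6 → ℝ) → ℝ} (hΨ : Continuous Ψ)
    (i : Fin 6) :
    ∃ K, ∀ w : ℝ → ℝ, JetDecay M w → ∀ x, |jet w x i * Ψ (jet w x)| ≤ K * (1 + x ^ 2)⁻¹ := by
  obtain ⟨B, hB⟩ := (isCompact_univ_pi fun k : Fin 6 =>
    isCompact_Icc (a := -M k) (b := M k)).exists_bound_of_continuousOn hΨ.continuousOn
  refine ⟨M i * B, fun w hw x => ?_⟩
  have hone : (1 + x ^ 2)⁻¹ ≤ 1 := inv_le_one_of_one_le₀ (by nlinarith [sq_nonneg x])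
  have hpos : 0 < (1 + x ^ 2)⁻¹ := by positivity
  have hM : ∀ k, 0 ≤ M k := fun k =>
    nonneg_of_mul_nonneg_left ((abs_nonneg _).trans (hw k x)) hpos
  have hmem : jet w x ∈ Set.pi univ fun k : Fin 6 => Icc (-M k) (M k) := fun k _ =>
    abs_le.1 ((hw k x).trans (mul_le_of_le_one_right (hM k) hone))
  have hb : |Ψ (jet w x)| ≤ B := hB _ hmem
  rw [abs_mul]
  calc |jet w x i| * |Ψ (jet w x)| ≤ M i * (1 + x ^ 2)⁻¹ * B :=
        mul_le_mul (hw i x) hb (abs_nonneg _) (mul_nonneg (hM i) hpos.le)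
    _ = M i * B * (1 + x ^ 2)⁻¹ := by ring

theorem JetDecay.integrable (hd : JetDecay M w) (hc : Continuous (jet w))
    {Ψ : (Fin 6 → ℝ) → ℝ} (hΨ : Continuous Ψ) (i : Fin 6) :
    Integrable fun x => jet w x i * Ψ (jet w x) := by
  obtain ⟨K, hK⟩ := JetDecay.exists_bound M hΨ i
  have hi : Continuous fun x => jet w x i := (continuous_apply i).comp hc
  exact (integrable_inv_one_add_sq.const_mul K).mono'
    (hi.mul (hΨ.comp hc)).aestronglyMeasurable (Eventually.of_forall fun x => hK w hd x)

end Decay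

section Continuity

variable {p : ℝ}

theorem continuous_velocity (hp : 5 < p) : Continuous (velocity p) := by
  have := continuous_weight hp
  unfold velocity
  fun_prop

theorem continuous_velocity₁ (hp : 5 < p) : Continuous (velocity₁ p) := by
  have := continuous_weight hp
  have := continuous_weight₁ hp
  unfold velocity₁
  fun_prop

theorem continuous_velocity₂ (hp : 5 < p) : Continuous (velocity₂ p) := by
  have := continuous_weight hp
  have := continuous_weight₁ hp
  have := continuous_weight₂ hp
  unfold velocity₂
  fun_prop

variable {w : ℝ → ℝ} {M : Fin 6 → ℝ}

theorem JetDecay.integrable_quadraticRate (hp : 5 < p) (hd : JetDecay M w)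
    (hc : Continuous (jet w)) : Integrable fun x => quadraticRate p (jet w x) :=
  hd.integrable hc (continuous_const.mul (continuous_velocity₂ hp)) 2

theorem continuous_correctionRate_factor (hp : 5 < p) : Continuous fun j : Fin 6 → ℝ =>
    2 * velocity₁ p j * weight p (j 0) + j 1 * weight₁ p (j 0) * velocity p j := by
  have := continuous_weight hp
  have := continuous_weight₁ hp
  have := continuous_velocity hp
  have := continuous_velocity₁ hp
  fun_prop

theorem JetDecay.integrable_correctionRate (hp : 5 < p) (hd : JetDecay M w)
    (hc : Continuous (jet w)) : Integrable fun x => correctionRate p (jet w x) :=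
  hd.integrable hc (continuous_correctionRate_factor hp) 1

theorem JetDecay.integrable_remainder (hp : 5 < p) (hd : JetDecay M w)
    (hc : Continuous (jet w)) : Integrable fun x => remainder p (jet w x) := by
  have := continuous_weight hp
  have := continuous_weight₁ hp
  have := continuous_weight₃ hp
  exact hd.integrable hc (Ψ := fun j => p / 12 * weight₃ p (j 0) * j 1 ^ 4 +
    5 * p ^ 2 / 3 * (weight p (j 0) * weight₁ p (j 0)) * j 1 ^ 2) (by fun_prop) 1

theorem JetDecay.integrable_flux (hp : 5 < p) (hd : JetDecay M w)
    (hc : Continuous (jet w)) : Integrable fun x => flux p (jet w x) := by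
  have := continuous_weight hp
  have := continuous_weight₁ hp
  have := continuous_weight₂ hp
  have := continuous_velocity hp
  have h2 := hd.integrable hc (Ψ := fun j => -(2 * j 4) - p * weight p (j 0) * j 2 -
      5 * p / 3 * (weight p (j 0) * j 2 + weight₁ p (j 0) * j 1 ^ 2)) (by fun_prop) 2
  have h3 := hd.integrable hc (Ψ := fun j => j 3) (by fun_prop) 3
  have h1 := hd.integrable hc (Ψ := fun j => -(p / 2 * weight₂ p (j 0) * j 1 ^ 3) -
      5 * p / 3 * (2 * weight p (j 0) * velocity p j - weight₂ p (j 0) * j 1 ^ 3 / 4 +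
        p * weight p (j 0) ^ 2 * j 1)) (by fun_prop) 1
  exact (h2.add h3).add h1

theorem JetDecay.integrable_abs_pow_mul (hd : JetDecay M w) (hc : Continuous (jet w))
    {a : ℝ} (ha : 0 ≤ a) (n : ℕ) :
    Integrable fun x => |jet w x 1| ^ (n + 1) * |jet w x 0| ^ a := by
  have := continuous_abs_rpow ha
  have h := (hd.integrable hc (Ψ := fun j => |j 1| ^ n * |j 0| ^ a) (by fun_prop) 1).abs
  refine h.congr (Eventually.of_forall fun x => ?_)
  simp only [abs_mul, abs_pow, abs_abs, abs_of_nonneg (Real.rpow_nonneg (abs_nonneg _) _)]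
  ring

end Continuity

/-- The integrated form of the integrations by parts. -/
theorem integral_rate_eq_integral_remainder {p : ℝ} (hp : 5 < p) {w : ℝ → ℝ}
    (hw : ∀ (k : ℕ) (x : ℝ), HasDerivAt (iteratedDeriv k w) (iteratedDeriv (k + 1) w x) x)
    {M : Fin 6 → ℝ} (hd : JetDecay M w) :
    (∫ x, quadraticRate p (jet w x)) - 5 * p / 3 * (∫ x, correctionRate p (jet w x)) =
      ∫ x, remainder p (jet w x) := by
  have hc := continuous_jet hw
  have hQ := hd.integrable_quadraticRate hp hc
  have hC := (hd.integrable_correctionRate hp hc).const_mul (5 * p / 3)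
  have hR := hd.integrable_remainder hp hc
  have h := integral_eq_zero_of_hasDerivAt_of_integrable (hasDerivAt_flux hw hp)
    ((hQ.sub hC).sub hR) (hd.integrable_flux hp hc)
  rw [integral_sub (by exact hQ.sub hC) hR, integral_sub hQ hC, integral_const_mul] at h
  exact sub_eq_zero.1 h

/-- The constant in the monotonicity inequality. -/
def monotonicityConst (p : ℝ) : ℝ :=
  p / 12 * ((p - 1) * (p - 2) * (p - 3)) + 5 * p ^ 2 / 3 * (p - 1)

theorem remainder_le {p : ℝ} (hp : 5 < p) (j : Fin 6 → ℝ) :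
    remainder p j ≤ monotonicityConst p *
      (|j 1| ^ 3 * |j 0| ^ (2 * p - 3) + |j 1| ^ 5 * |j 0| ^ (p - 4)) := by
  have h1 : 0 < p - 1 := by linarith
  have h2 : 0 < p - 2 := by linarith
  have h3 : 0 < p - 3 := by linarith
  have hp0 : 0 < p := by linarith
  have hA : 0 ≤ |j 1| ^ 3 * |j 0| ^ (2 * p - 3) := by positivity
  have hB : 0 ≤ |j 1| ^ 5 * |j 0| ^ (p - 4) := by positivity
  have e3 : weight₃ p (j 0) * j 1 ^ 5 ≤
      (p - 1) * (p - 2) * (p - 3) * (|j 1| ^ 5 * |j 0| ^ (p - 4)) := by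
    refine (le_abs_self _).trans_eq ?_
    rw [abs_mul, abs_weight₃ hp, abs_pow]
    ring
  have e1 : weight p (j 0) * weight₁ p (j 0) * j 1 ^ 3 ≤
      (p - 1) * (|j 1| ^ 3 * |j 0| ^ (2 * p - 3)) := by
    refine (le_abs_self _).trans_eq ?_
    rw [abs_mul, abs_weight_mul_weight₁ hp, abs_pow]
    ring
  set A := |j 1| ^ 3 * |j 0| ^ (2 * p - 3)
  set B := |j 1| ^ 5 * |j 0| ^ (p - 4)
  calc remainder p j = p / 12 * (weight₃ p (j 0) * j 1 ^ 5) +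
        5 * p ^ 2 / 3 * (weight p (j 0) * weight₁ p (j 0) * j 1 ^ 3) := by
        rw [remainder]; ring
    _ ≤ p / 12 * ((p - 1) * (p - 2) * (p - 3) * B) + 5 * p ^ 2 / 3 * ((p - 1) * A) := by
        gcongr
    _ ≤ p / 12 * ((p - 1) * (p - 2) * (p - 3) * B) + 5 * p ^ 2 / 3 * ((p - 1) * A) +
        (p / 12 * ((p - 1) * (p - 2) * (p - 3)) * A + 5 * p ^ 2 / 3 * (p - 1) * B) :=
        le_add_of_nonneg_right (by positivity)
    _ = monotonicityConst p * (A + B) := by rw [monotonicityConst]; ring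

theorem integral_remainder_le {p : ℝ} (hp : 5 < p) {w : ℝ → ℝ} {M : Fin 6 → ℝ}
    (hd : JetDecay M w) (hc : Continuous (jet w)) :
    ∫ x, remainder p (jet w x) ≤ monotonicityConst p *
      ((∫ x, |jet w x 1| ^ 3 * |jet w x 0| ^ (2 * p - 3)) +
        ∫ x, |jet w x 1| ^ 5 * |jet w x 0| ^ (p - 4)) := by
  have hA := hd.integrable_abs_pow_mul hc (show 0 ≤ 2 * p - 3 by linarith) 2
  have hB := hd.integrable_abs_pow_mul hc (show 0 ≤ p - 4 by linarith) 4
  rw [← integral_add hA hB, ← integral_const_mul]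
  exact integral_mono (hd.integrable_remainder hp hc) ((hA.add hB).const_mul _)
    fun x => remainder_le hp (jet w x)

/-! ### The time domain and the equation -/

theorem convex_timeDomain (T : EReal) : Convex ℝ (timeDomain T) := by
  refine Set.OrdConnected.convex ⟨fun a ha b hb c hc => ⟨ha.1.trans hc.1, ?_⟩⟩
  exact lt_of_le_of_lt (EReal.coe_le_coe_iff.2 hc.2) hb.2

theorem nonempty_interior_timeDomain {T : EReal} (hT : 0 < T) :
    (interior (timeDomain T)).Nonempty := by
  obtain ⟨r, hr0, hrT⟩ := EReal.lt_iff_exists_real_btwn.1 hT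
  have hr : 0 < r := EReal.coe_pos.1 hr0
  have hsub : Ioo 0 r ⊆ timeDomain T := fun t ht =>
    ⟨ht.1.le, lt_trans (EReal.coe_lt_coe_iff.2 ht.2) hrT⟩
  exact ⟨r / 2, interior_maximal hsub isOpen_Ioo ⟨by linarith, by linarith⟩⟩

section Solution

variable {p : ℝ} {T : EReal} {u : ℝ → ℝ → ℝ}

theorem RapidDecayLocUnif.eventually_jetDecay (hdec : RapidDecayLocUnif T u) {t₀ : ℝ}
    (ht₀ : t₀ ∈ timeDomain T) :
    ∃ M, ∀ᶠ t in 𝓝[timeDomain T] t₀, JetDecay M (u t) := by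
  choose ε hε C hC using fun k : Fin 6 => hdec 2 k t₀ ht₀
  refine ⟨C, eventually_all.2 fun k => ?_⟩
  have hnear : ∀ᶠ t in 𝓝[timeDomain T] t₀, t ∈ Metric.ball t₀ (ε k) :=
    mem_nhdsWithin_of_mem_nhds (Metric.ball_mem_nhds _ (hε k))
  filter_upwards [hnear, eventually_mem_nhdsWithin] with t ht htT x
  have h := hC k t htT ht x
  have hpos : 0 < 1 + x ^ 2 := by positivity
  rw [← div_eq_mul_inv, le_div_iff₀ hpos, mul_comm]
  refine le_trans (mul_le_mul_of_nonneg_right ?_ (abs_nonneg _)) h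
  nlinarith [sq_abs x, abs_nonneg x]

variable (hT : 0 < T)
  (hu : ContDiffOn ℝ (⊤ : ℕ∞) (fun q : ℝ × ℝ => u q.1 q.2) (timeDomain T ×ˢ univ))

include hT hu

theorem hasDerivAt_iteratedDeriv_slice {t : ℝ} (ht : t ∈ timeDomain T) (k : ℕ) (x : ℝ) :
    HasDerivAt (iteratedDeriv k (u t)) (iteratedDeriv (k + 1) (u t) x) x := by
  have hS := convex_timeDomain T
  have hne := nonempty_interior_timeDomain hT
  rw [iteratedDeriv_eq_iterate_stripDeriv hu hS hne k ht,
    iteratedDeriv_eq_iterate_stripDeriv hu hS hne (k + 1) ht, Function.iterate_succ_apply']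
  exact hasDerivAt_stripDeriv (contDiffOn_iterate_stripDeriv hu hS hne k) ht x

theorem continuousOn_jet_time (x : ℝ) :
    ContinuousOn (fun t => jet (u t) x) (timeDomain T) := by
  have hS := convex_timeDomain T
  have hne := nonempty_interior_timeDomain hT
  refine continuousOn_pi.2 fun k => ?_
  have h : ContinuousOn (fun t => (stripDeriv (timeDomain T) (0, 1))^[k] u t x)
      (timeDomain T) := fun t ht =>
    (hasDerivWithinAt_stripDeriv
      (contDiffOn_iterate_stripDeriv hu hS hne k) ht x).continuousWithinAt
  refine h.congr fun t ht => ?_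
  rw [jet, iteratedDeriv_eq_iterate_stripDeriv hu hS hne k ht]

variable (hp : 5 < p) (hsol : IsGKdVSolution p T u)

include hp hsol

/-- The equation holds up to the initial time, with one-sided time derivatives. -/
theorem stripDeriv_time_eq_velocity {t : ℝ} (ht : t ∈ timeDomain T) (x : ℝ) :
    stripDeriv (timeDomain T) (1, 0) u t x = velocity p (jet (u t) x) := by
  have hS := convex_timeDomain T
  have hne := nonempty_interior_timeDomain hT
  have hint : EqOn (fun t => stripDeriv (timeDomain T) (1, 0) u t x)
      (fun t => velocity p (jet (u t) x)) (interior (timeDomain T)) := by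
    intro s hs
    have hsT := interior_subset hs
    have htime := ((hasDerivWithinAt_stripDeriv hu hsT x).hasDerivAt
      (mem_interior_iff_mem_nhds.1 hs)).deriv
    have hw := hasDerivAt_iteratedDeriv_slice hT hu hsT
    have h0 : HasDerivAt (u s) (jet (u s) x 1) x := by
      have := hw 0 x
      rwa [iteratedDeriv_zero] at this
    have h2 : HasDerivAt (deriv (deriv (u s))) (jet (u s) x 3) x := by
      have := hw 2 x
      rwa [iteratedDeriv_succ, iteratedDeriv_one] at this
    have f0 := (hasDerivAt_weight hp (u s x)).comp x h0
    have hspace := (h2.add (h0.mul f0)).deriv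
    have heq := hsol s hsT x
    have hz : jet (u s) x 0 = u s x := by simp [jet]
    have hww := weight₁_mul_self hp (u s x)
    rw [htime] at heq
    change _ + deriv (deriv (deriv (u s)) + u s * weight p ∘ u s) x = 0 at heq
    rw [hspace] at heq
    simp only [Function.comp] at heq
    simp only [velocity, hz]
    linear_combination heq - jet (u s) x 1 * hww
  refine hint.of_subset_closure
    (fun s hs => (hasDerivWithinAt_stripDeriv
      (contDiffOn_stripDeriv hu hS hne (1, 0)) hs x).continuousWithinAt)
    ((continuous_velocity hp).comp_continuousOn (continuousOn_jet_time hT hu x))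
    interior_subset ?_ ht
  rw [hS.closure_interior_eq_closure_of_nonempty_interior hne]
  exact subset_closure

theorem hasDerivWithinAt_jet_time {t : ℝ} (ht : t ∈ timeDomain T) (x : ℝ) :
    HasDerivWithinAt (fun s => jet (u s) x 0) (velocity p (jet (u t) x)) (timeDomain T) t ∧
    HasDerivWithinAt (fun s => jet (u s) x 1) (velocity₁ p (jet (u t) x)) (timeDomain T) t ∧
    HasDerivWithinAt (fun s => jet (u s) x 2) (velocity₂ p (jet (u t) x)) (timeDomain T) t := by
  have hS := convex_timeDomain T
  have hne := nonempty_interior_timeDomain hT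
  have hw := hasDerivAt_iteratedDeriv_slice hT hu ht
  have hsmooth := contDiffOn_iterate_stripDeriv hu hS hne
  have hjet : ∀ k : Fin 6, HasDerivWithinAt (fun s => jet (u s) x k)
      (stripDeriv (timeDomain T) (1, 0) ((stripDeriv (timeDomain T) (0, 1))^[k] u) t x)
      (timeDomain T) t := fun k =>
    (hasDerivWithinAt_stripDeriv (hsmooth k) ht x).congr_of_mem
      (fun s hs => by rw [jet, iteratedDeriv_eq_iterate_stripDeriv hu hS hne k hs]) ht
  have e0 : stripDeriv (timeDomain T) (1, 0) u t = fun y => velocity p (jet (u t) y) :=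
    funext fun y => stripDeriv_time_eq_velocity hT hu hp hsol ht y
  have e1 : stripDeriv (timeDomain T) (1, 0) (stripDeriv (timeDomain T) (0, 1) u) t =
      fun y => velocity₁ p (jet (u t) y) := by
    funext y
    have h := hasDerivAt_stripDeriv_time hu hS hne ht y
    rw [e0] at h
    exact h.unique (hasDerivAt_velocity hw hp y)
  have e2 : stripDeriv (timeDomain T) (1, 0)
      (stripDeriv (timeDomain T) (0, 1) (stripDeriv (timeDomain T) (0, 1) u)) t x =
      velocity₂ p (jet (u t) x) := by
    have h := hasDerivAt_stripDeriv_time (hsmooth 1) hS hne ht x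
    simp only [Function.iterate_one] at h
    rw [e1] at h
    exact h.unique (hasDerivAt_velocity₁ hw hp x)
  refine ⟨(hjet 0).congr_deriv (congrFun e0 x), (hjet 1).congr_deriv (congrFun e1 x),
    (hjet 2).congr_deriv e2⟩

theorem hasDerivWithinAt_quadratic (hdec : RapidDecayLocUnif T u) {t : ℝ}
    (ht : t ∈ timeDomain T) :
    HasDerivWithinAt (fun s => ∫ x, jet (u s) x 2 ^ 2)
      (∫ x, quadraticRate p (jet (u t) x)) (timeDomain T) t := by
  obtain ⟨M, hM⟩ := hdec.eventually_jetDecay ht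
  obtain ⟨K, hK⟩ := JetDecay.exists_bound M
    (continuous_const.mul (continuous_velocity₂ hp) : Continuous fun j => 2 * velocity₂ p j) 2
  refine hasDerivWithinAt_integral_of_dominated (convex_timeDomain T) ht
    (F' := fun s x => quadraticRate p (jet (u s) x)) ?_
    (hM.mono fun s hs => hK (u s) hs) (integrable_inv_one_add_sq.const_mul K) ?_
  · filter_upwards [hM, eventually_mem_nhdsWithin] with s hs hsT
    have hc := continuous_jet (hasDerivAt_iteratedDeriv_slice hT hu hsT)
    simpa only [sq] using hs.integrable hc (continuous_apply 2) 2
  · intro s hs x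
    refine ((hasDerivWithinAt_jet_time hT hu hp hsol hs x).2.2.pow 2).congr_deriv ?_
    simp only [quadraticRate]
    push_cast
    ring

theorem hasDerivWithinAt_correction (hdec : RapidDecayLocUnif T u) {t : ℝ}
    (ht : t ∈ timeDomain T) :
    HasDerivWithinAt (fun s => ∫ x, jet (u s) x 1 ^ 2 * weight p (jet (u s) x 0))
      (∫ x, correctionRate p (jet (u t) x)) (timeDomain T) t := by
  obtain ⟨M, hM⟩ := hdec.eventually_jetDecay ht
  obtain ⟨K, hK⟩ := JetDecay.exists_bound M (continuous_correctionRate_factor hp) 1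
  refine hasDerivWithinAt_integral_of_dominated (convex_timeDomain T) ht
    (F' := fun s x => correctionRate p (jet (u s) x)) ?_
    (hM.mono fun s hs => hK (u s) hs) (integrable_inv_one_add_sq.const_mul K) ?_
  · filter_upwards [hM, eventually_mem_nhdsWithin] with s hs hsT
    have hc := continuous_jet (hasDerivAt_iteratedDeriv_slice hT hu hsT)
    have := continuous_weight hp
    simpa only [sq, mul_assoc] using
      hs.integrable hc (Ψ := fun j => j 1 * weight p (j 0)) (by fun_prop) 1
  · intro s hs x
    obtain ⟨h0, h1, -⟩ := hasDerivWithinAt_jet_time hT hu hp hsol hs x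
    refine ((h1.pow 2).mul
      ((hasDerivAt_weight hp (jet (u s) x 0)).comp_hasDerivWithinAt s h0)).congr_deriv ?_
    simp only [correctionRate, Function.comp, Pi.pow_apply]
    push_cast
    ring

end Solution

/-- for `5 < p < 6` there is a constant `C > 0` depending only on `p` such
that for every smooth rapidly decaying solution of the gKdV equation on `[0,T)`,
`T ∈ (0,∞]`, the pseudo-energy `E₂` is differentiable in time with
`d/dt E₂(t) ≤ C (∫ |∂ₓu|³|u|^{2p-3} + ∫ |∂ₓu|⁵|u|^{p-4})`. -/
theorem gKdV_pseudoEnergy_monotonicity (p : ℝ) (hp₁ : 5 < p) (hp₂ : p < 6) :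
    ∃ C : ℝ, 0 < C ∧
      ∀ T : EReal, 0 < T →
      ∀ u : ℝ → ℝ → ℝ,
        ContDiffOn ℝ (⊤:ℕ∞) (fun q : ℝ × ℝ => u q.1 q.2) (timeDomain T ×ˢ univ) →
        RapidDecayLocUnif T u →
        IsGKdVSolution p T u →
        ∀ t ∈ timeDomain T, ∃ d : ℝ,
          HasDerivWithinAt (pseudoEnergy p u) d (timeDomain T) t ∧
          d ≤ C * ((∫ x : ℝ, |deriv (u t) x| ^ 3 * |u t x| ^ (2*p - 3)) +
                   (∫ x : ℝ, |deriv (u t) x| ^ 5 * |u t x| ^ (p - 4))) := by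
  refine ⟨monotonicityConst p, ?_, ?_⟩
  · have h1 : 0 < p - 1 := by linarith
    have h2 : 0 < p - 2 := by linarith
    have h3 : 0 < p - 3 := by linarith
    have hp0 : 0 < p := by linarith
    unfold monotonicityConst
    positivity
  intro T hT u hu hdec hsol t ht
  obtain ⟨M, hM⟩ := hdec.eventually_jetDecay ht
  have hd : JetDecay M (u t) := hM.self_of_nhdsWithin ht
  have hw := hasDerivAt_iteratedDeriv_slice hT hu ht
  refine ⟨(∫ x, quadraticRate p (jet (u t) x)) -
    5 * p / 3 * ∫ x, correctionRate p (jet (u t) x), ?_, ?_⟩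
  · have h := (hasDerivWithinAt_quadratic hT hu hp₁ hsol hdec ht).sub
      ((hasDerivWithinAt_correction hT hu hp₁ hsol hdec ht).const_mul (5 * p / 3))
    refine h.congr_of_mem (fun s _ => ?_) ht
    simp [pseudoEnergy, jet, weight, iteratedDeriv_succ]
  · rw [integral_rate_eq_integral_remainder hp₁ hw hd]
    have h := integral_remainder_le hp₁ hd (continuous_jet hw)
    simpa [jet, iteratedDeriv_succ] using h


end
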